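/- Let X be a real random variable with E[|X|^{1+ε}] ≤ u^{1+ε} for some ε ∈ (0,1] and u > 0, let B > 0, and set d := sat(X,B) − E[sat(X,B)]. Then (i) |d| ≤ 2B almost surely, and (ii) E[d²] ≤ u^{1+ε}·B^{1−ε}. -/

import Mathlib

open MeasureTheory Real

/-- `sat(x,B) := sign(x) · min(|x|, B)`. -/
noncomputable def sat (x B : ℝ) : ℝ := Real.sign x * min |x| B

theorem sat_eq_clamp (x B : ℝ) (hB : 0 < B) : sat x B = max (-B) (min x B) := by
  unfold sat
  rcases lt_trichotomy x 0 with h | h | h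
  · rw [Real.sign_of_neg h, abs_of_neg h, min_eq_left (by linarith : x ≤ B)]
    rcases le_total (-x) B with h1 | h1
    · rw [min_eq_left h1, max_eq_right (by linarith)]; ring
    · rw [min_eq_right h1, max_eq_left (by linarith)]; ring
  · subst h
    simp [hB.le]
  · rw [Real.sign_of_pos h, abs_of_pos h, one_mul, max_eq_right]
    exact le_min (by linarith) (by linarith)

theorem sat_abs_le (x B : ℝ) (hB : 0 < B) : |sat x B| ≤ B := by
  rw [sat_eq_clamp x B hB, abs_le]
  exact ⟨le_max_left _ _, max_le (by linarith) (min_le_right _ _)⟩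

theorem sat_sq_le (x B ε : ℝ) (hB : 0 < B) (hε : ε ∈ Set.Ioc (0 : ℝ) 1) :
    (sat x B) ^ 2 ≤ |x| ^ (1 + ε) * B ^ (1 - ε) := by
  obtain ⟨h0, h1⟩ := hε
  have hm : 0 ≤ min |x| B := le_min (abs_nonneg x) hB.le
  have hs : (sat x B) ^ 2 ≤ (min |x| B) ^ 2 := by
    unfold sat
    rw [mul_pow]
    have : (Real.sign x) ^ 2 ≤ 1 := by
      rcases Real.sign_apply_eq x with h | h | h <;> rw [h] <;> norm_num
    nlinarith [sq_nonneg (min |x| B)]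
  have he : (min |x| B) ^ 2 = (min |x| B) ^ (1 + ε) * (min |x| B) ^ (1 - ε) := by
    rw [← Real.rpow_add_of_nonneg hm (by linarith) (by linarith), ← Real.rpow_natCast]
    congr 1
    push_cast
    ring
  rw [he] at hs
  refine hs.trans ?_
  apply mul_le_mul
  · exact Real.rpow_le_rpow hm (min_le_left _ _) (by linarith)
  · exact Real.rpow_le_rpow hm (min_le_right _ _) (by linarith)
  · exact Real.rpow_nonneg hm _
  · exact Real.rpow_nonneg (abs_nonneg x) _

/-- **Properties of the centered saturated variable `d`.**
Let `X` satisfy `E[|X|^{1+ε}] ≤ u^{1+ε}` with `ε ∈ (0,1]`, `u > 0`, let `B > 0`, and set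
`d := sat(X,B) − E[sat(X,B)]`.  Then (i) `|d| ≤ 2B` almost surely, and
(ii) `E[d²] ≤ u^{1+ε} · B^{1−ε}`. -/
theorem centered_saturated_properties
    {Ω : Type*} [MeasurableSpace Ω] (ℙ : Measure Ω) [IsProbabilityMeasure ℙ]
    (X : Ω → ℝ) (hXmeas : Measurable X)
    (u ε B : ℝ) (hε : ε ∈ Set.Ioc (0 : ℝ) 1) (hu : 0 < u) (hB : 0 < B)
    (hmomint : Integrable (fun ω => |X ω| ^ (1 + ε)) ℙ)
    (hmom : ∫ ω, |X ω| ^ (1 + ε) ∂ℙ ≤ u ^ (1 + ε))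
    (d : Ω → ℝ) (hd : d = fun ω => sat (X ω) B - ∫ ω', sat (X ω') B ∂ℙ) :
    (∀ᵐ ω ∂ℙ, |d ω| ≤ 2 * B) ∧ (∫ ω, (d ω) ^ 2 ∂ℙ ≤ u ^ (1 + ε) * B ^ (1 - ε)) := by
  have hmeas : Measurable (fun ω => sat (X ω) B) := by
    have : (fun ω => sat (X ω) B) = fun ω => max (-B) (min (X ω) B) :=
      funext fun ω => sat_eq_clamp _ _ hB
    rw [this]
    exact measurable_const.max (hXmeas.min measurable_const)
  have hint : Integrable (fun ω => sat (X ω) B) ℙ :=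
    Integrable.of_bound hmeas.aestronglyMeasurable B
      (Filter.Eventually.of_forall fun ω => sat_abs_le _ _ hB)
  have hint2 : Integrable (fun ω => (sat (X ω) B) ^ 2) ℙ := by
    refine Integrable.of_bound (hmeas.pow_const 2).aestronglyMeasurable (B ^ 2)
      (Filter.Eventually.of_forall fun ω => ?_)
    rw [norm_pow]
    exact pow_le_pow_left₀ (norm_nonneg _) (sat_abs_le _ _ hB) 2
  have hmean : |∫ ω', sat (X ω') B ∂ℙ| ≤ B := by
    have := norm_integral_le_of_norm_le_const (μ := ℙ) (f := fun ω => sat (X ω) B)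
      (C := B) (Filter.Eventually.of_forall fun ω => sat_abs_le _ _ hB)
    simpa using this
  subst hd
  set m := ∫ ω', sat (X ω') B ∂ℙ with hm
  constructor
  · refine Filter.Eventually.of_forall fun ω => ?_
    have h1 := abs_le.mp (sat_abs_le (X ω) B hB)
    have h2 := abs_le.mp hmean
    exact abs_le.mpr ⟨by linarith, by linarith⟩
  · have e : ∫ ω, (sat (X ω) B - m) ^ 2 ∂ℙ = ∫ ω, (sat (X ω) B) ^ 2 ∂ℙ - m ^ 2 := by
      have e1 : (fun ω => (sat (X ω) B - m) ^ 2)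
          = fun ω => ((sat (X ω) B) ^ 2 - (2 * m) * sat (X ω) B) + m ^ 2 := by
        funext ω; ring
      have i1 : Integrable (fun ω => (sat (X ω) B) ^ 2 - (2 * m) * sat (X ω) B) ℙ :=
        hint2.sub (hint.const_mul _)
      rw [e1, integral_add i1 (integrable_const _),
        integral_sub hint2 (hint.const_mul _), integral_const_mul, ← hm]
      simp
      ring
    have h3 : ∫ ω, (sat (X ω) B) ^ 2 ∂ℙ ≤ ∫ ω, |X ω| ^ (1 + ε) * B ^ (1 - ε) ∂ℙ :=
      integral_mono hint2 (hmomint.mul_const _) fun ω => sat_sq_le _ _ _ hB hε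
    rw [integral_mul_const] at h3
    have h4 := mul_le_mul_of_nonneg_right hmom (Real.rpow_nonneg hB.le (1 - ε))
    change ∫ ω, (sat (X ω) B - m) ^ 2 ∂ℙ ≤ _
    rw [e]
    nlinarith [sq_nonneg m]
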